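/- arXiv:2402.13621 — 5 statements merged into one kernel-verified Lean document; each statement's English description precedes it below -/
import Mathlib

section
/- Let L be a positive definite even lattice of rank ℓ and let g ∈ O(L) be a completely fixed point free isometry of order n ≥ 2. Then φ(n) divides ℓ, and the characteristic polynomial of the ℚ-linear extension of g acting on ℚ ⊗_ℤ L equals Φ_n(x)^{ℓ/φ(n)}, where φ is the Euler totient function and Φ_n is the n-th cyclotomic polynomial. -/
open Polynomial in
theorem aux_int_algebra {A : Type*} [Ring A] (a b : Algebra ℤ A) (x : A) (p : ℤ[X])
    (h : @aeval ℤ A _ _ a x p = 0) : @aeval ℤ A _ _ b x p = 0 := by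
  have hab : a = b := Subsingleton.elim a b
  subst hab
  exact h

open Polynomial in
theorem aux_aeval_baseChange {R A M : Type*} [CommRing R] [CommRing A] [Algebra R A]
    [AddCommGroup M] [Module R M] (f : Module.End R M) (p : R[X])
    (h : aeval f p = 0) : aeval (LinearMap.baseChange A f) (p.map (algebraMap R A)) = 0 := by
  have h1 := Polynomial.aeval_algHom_apply (Module.End.baseChangeHom R A M) f p
  rw [h, map_zero] at h1
  rw [Polynomial.aeval_map_algebraMap]
  exact h1

open Polynomial in
theorem aux_charpoly_pow {K V : Type*} [Field K] [AddCommGroup V] [Module K V]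
    [Module.Finite K V] (f : Module.End K V) (p : K[X]) (hp : Irreducible p) (hm : p.Monic)
    (h : aeval f p = 0) : ∃ k, f.charpoly = p ^ k := by
  classical
  have hc : f.charpoly.Monic := f.charpoly_monic
  have key : ∀ q ∈ UniqueFactorizationMonoid.normalizedFactors f.charpoly, q = p := by
    intro q hq
    have hqi := UniqueFactorizationMonoid.irreducible_of_normalized_factor q hq
    have hqd := UniqueFactorizationMonoid.dvd_of_mem_normalizedFactors hq
    have hqm : q.Monic := by
      have := UniqueFactorizationMonoid.normalize_normalized_factor q hq
      rw [← this]
      exact Polynomial.monic_normalize hqi.ne_zero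
    obtain ⟨μ, hμ⟩ := IsAlgClosed.exists_aeval_eq_zero (AlgebraicClosure K) q
      (by exact (Polynomial.degree_pos_of_irreducible hqi).ne')
    have hr : aeval μ f.charpoly = 0 := by
      obtain ⟨r, hr⟩ := hqd
      rw [hr, map_mul, hμ, zero_mul]
    have hroot : (LinearMap.baseChange (AlgebraicClosure K) f).charpoly.IsRoot μ := by
      rw [LinearMap.charpoly_baseChange, Polynomial.IsRoot, Polynomial.eval_map_algebraMap, hr]
    rw [← Module.End.hasEigenvalue_iff_isRoot_charpoly] at hroot
    obtain ⟨v, hv⟩ := hroot.exists_hasEigenvector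
    have h2 := Module.End.aeval_apply_of_hasEigenvector
      (p := p.map (algebraMap K (AlgebraicClosure K))) hv
    rw [aux_aeval_baseChange f p h] at h2
    have h3 : aeval μ p = 0 := by
      have := (smul_eq_zero.mp h2.symm).resolve_right hv.2
      rwa [Polynomial.eval_map_algebraMap] at this
    rw [minpoly.eq_of_irreducible_of_monic hqi hμ hqm,
      minpoly.eq_of_irreducible_of_monic hp h3 hm]
  have h4 := UniqueFactorizationMonoid.prod_normalizedFactors hc.ne_zero
  rw [Multiset.eq_replicate_of_mem key, Multiset.prod_replicate] at h4
  exact ⟨_, (Polynomial.eq_of_monic_of_associated (hm.pow _) hc h4).symm⟩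

open TensorProduct in
/-- For a positive definite even lattice `L` of rank `ℓ` and a completely
fixed point free isometry `g ∈ O(L)` of order `n ≥ 2`, `φ(n)` divides `ℓ` and the
characteristic polynomial of the `ℚ`-linear extension of `g` on `ℚ ⊗ L` equals
`Φ_n(x)^{ℓ/φ(n)}`. -/
theorem charpoly_of_completely_fixed_point_free
    (L : Type*) [AddCommGroup L] [Module ℤ L] [Module.Free ℤ L] [Module.Finite ℤ L]
    (B : L →ₗ[ℤ] L →ₗ[ℤ] ℤ)
    (hsymm : ∀ x y : L, B x y = B y x)
    (hpos : ∀ x : L, x ≠ 0 → 0 < B x x)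
    (heven : ∀ x : L, 2 ∣ B x x)
    (g : L ≃ₗ[ℤ] L)
    (hg : ∀ x y : L, B (g x) (g y) = B x y)
    (n : ℕ) (hn : 2 ≤ n) (horder : orderOf g = n)
    (hfpf : ∀ i : ℕ, 1 ≤ i → i ≤ n - 1 → ∀ α : L, (g ^ i) α = α → α = 0) :
    Nat.totient n ∣ Module.finrank ℤ L ∧
    LinearMap.charpoly (LinearMap.baseChange ℚ g.toLinearMap) =
      (Polynomial.cyclotomic n ℚ) ^ (Module.finrank ℤ L / Nat.totient n) := by
  have hn0 : 0 < n := by omega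
  have hpow : ∀ (i : ℕ) (x : L), (g ^ i) x = ((g.toLinearMap : Module.End ℤ L) ^ i) x := by
    intro i
    induction i with
    | zero => intro x; rfl
    | succ i ih => intro x; rw [pow_succ, pow_succ]; exact ih (g x)
  have hcyc : Polynomial.aeval (g.toLinearMap : Module.End ℤ L) (Polynomial.cyclotomic n ℤ) = 0 := by
    have hinj : ∀ d ∈ n.properDivisors, ∀ x : L,
        Polynomial.aeval (g.toLinearMap : Module.End ℤ L) (Polynomial.cyclotomic d ℤ) x = 0 →
          x = 0 := by
      intro d hd x hx
      rw [Nat.mem_properDivisors] at hd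
      have hd0 : 0 < d := Nat.pos_of_dvd_of_pos hd.1 hn0
      apply hfpf d hd0 (by omega) x
      obtain ⟨r, hr⟩ := Polynomial.cyclotomic.dvd_X_pow_sub_one d ℤ
      have h1 := congrArg (fun q => Polynomial.aeval (g.toLinearMap : Module.End ℤ L) q x) hr
      simp only [mul_comm _ r, map_mul, Module.End.mul_apply, hx, map_zero, map_sub, map_pow,
        Polynomial.aeval_X, map_one, LinearMap.sub_apply, Module.End.one_apply] at h1
      rw [hpow]
      exact sub_eq_zero.mp h1
    have hprod : ∀ s : Finset ℕ, s ⊆ n.properDivisors → ∀ x : L,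
        Polynomial.aeval (g.toLinearMap : Module.End ℤ L)
          (∏ d ∈ s, Polynomial.cyclotomic d ℤ) x = 0 → x = 0 := by
      intro s
      induction s using Finset.induction_on with
      | empty => intro _ x hx; simpa using hx
      | insert a s ha ih =>
        intro hs x hx
        rw [Finset.prod_insert ha, map_mul, Module.End.mul_apply] at hx
        exact ih (fun y hy => hs (Finset.mem_insert_of_mem hy)) x
          (hinj a (hs (Finset.mem_insert_self a s)) _ hx)
    ext x
    apply hprod _ subset_rfl
    have hX : (∏ d ∈ n.properDivisors, Polynomial.cyclotomic d ℤ) * Polynomial.cyclotomic n ℤ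
        = Polynomial.X ^ n - 1 := by
      rw [← Polynomial.prod_cyclotomic_eq_X_pow_sub_one hn0,
        ← Nat.insert_self_properDivisors hn0.ne', Finset.prod_insert Nat.self_notMem_properDivisors,
        mul_comm]
    rw [← Module.End.mul_apply, ← map_mul, hX]
    have hgn : g ^ n = 1 := by rw [← horder]; exact pow_orderOf_eq_one g
    have h2 := hpow n x
    rw [hgn] at h2
    simp only [map_sub, map_pow, Polynomial.aeval_X, map_one, LinearMap.sub_apply, ← h2]
    exact sub_self x
  obtain ⟨k, hk⟩ := aux_charpoly_pow (LinearMap.baseChange ℚ g.toLinearMap)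
    (Polynomial.cyclotomic n ℚ) (Polynomial.cyclotomic.irreducible_rat hn0)
    (Polynomial.cyclotomic.monic n ℚ) (by
      have := aux_aeval_baseChange (A := ℚ) (g.toLinearMap : Module.End ℤ L)
        (Polynomial.cyclotomic n ℤ) (aux_int_algebra _ _ _ _ hcyc)
      rwa [Polynomial.map_cyclotomic] at this)
  have hdeg := congrArg Polynomial.natDegree hk
  rw [LinearMap.charpoly_natDegree, Polynomial.natDegree_pow, Polynomial.natDegree_cyclotomic,
    Module.finrank_baseChange] at hdeg
  have ht : 0 < n.totient := Nat.totient_pos.mpr hn0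
  refine ⟨⟨k, by rw [hdeg, mul_comm]⟩, ?_⟩
  rw [hk, hdeg, Nat.mul_div_cancel _ ht]
end

section
/- Let L be a positive definite even lattice of rank ℓ and let g ∈ O(L) be a completely fixed point free isometry of order n ≥ 2. Let 𝔥 = ℂ ⊗_ℤ L and for 0 ≤ j ≤ n−1 let 𝔥_{(j)} = {v ∈ 𝔥 : gv = e^{2πi j/n} v}. Then dim_ℂ 𝔥_{(j)} = ℓ/φ(n) if gcd(j,n) = 1, and dim_ℂ 𝔥_{(j)} = 0 otherwise, where φ is the Euler totient function. -/
open Polynomial in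
lemma cffp_prod_injective {L : Type*} [AddCommGroup L] [Module ℤ L]
    (f : Module.End ℤ L) (s : Finset ℕ) (P : ℕ → ℤ[X])
    (h : ∀ d ∈ s, Function.Injective (aeval f (P d))) :
    Function.Injective (aeval f (∏ d ∈ s, P d)) := by
  classical
  induction s using Finset.induction_on with
  | empty => 
    simp only [Finset.prod_empty, map_one]
    exact fun x y hxy => hxy
  | insert a s ha ih =>
    rw [Finset.prod_insert ha, map_mul, Module.End.mul_eq_comp, LinearMap.coe_comp]
    exact (h a (by simp)).comp (ih fun d hd => h d (by simp [hd]))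

open Polynomial in
lemma cffp_aeval_cyclotomic {L : Type*} [AddCommGroup L] [Module ℤ L]
    (f : Module.End ℤ L) (n : ℕ) (hn : 2 ≤ n) (hf : f ^ n = 1)
    (hfpf : ∀ i : ℕ, 1 ≤ i → i ≤ n - 1 → ∀ α : L, (f ^ i) α = α → α = 0) :
    aeval f (cyclotomic n ℤ) = 0 := by
  have key : Function.Injective (aeval f (∏ d ∈ n.properDivisors, cyclotomic d ℤ)) := by
    apply cffp_prod_injective
    intro d hd
    rw [Nat.mem_properDivisors] at hd
    have hd0 : 0 < d := Nat.pos_of_dvd_of_pos hd.1 (by omega)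
    obtain ⟨q, hq⟩ := cyclotomic.dvd_X_pow_sub_one d ℤ
    rw [injective_iff_map_eq_zero]
    intro x hx
    apply hfpf d hd0 (by omega)
    have h1 : aeval f (X ^ d - 1 : ℤ[X]) x = 0 := by
      rw [hq, mul_comm, map_mul, Module.End.mul_apply, hx, map_zero]
    have h2 : aeval f (X ^ d - 1 : ℤ[X]) = f ^ d - 1 := by simp
    rw [h2] at h1
    simpa [sub_eq_zero] using h1
  have h0 : aeval f ((∏ d ∈ n.properDivisors, cyclotomic d ℤ) * cyclotomic n ℤ) = 0 := by
    have : (∏ d ∈ n.properDivisors, cyclotomic d ℤ) * cyclotomic n ℤ = X ^ n - 1 := by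
      rw [← prod_cyclotomic_eq_X_pow_sub_one (by omega : 0 < n),
        ← Nat.insert_self_properDivisors (by omega), Finset.prod_insert (by simp), mul_comm]
    rw [this]
    simp [hf]
  ext x
  apply key
  have := congrArg (fun F : Module.End ℤ L => F x) h0
  simpa using this

open Polynomial in
lemma cffp_poly (n : ℕ) (hn : 2 ≤ n) (q : ℤ[X]) (hq : q.Monic)
    (h : ∀ z : ℂ, aeval z q = 0 → IsPrimitiveRoot z n) :
    ∃ k : ℕ, q = cyclotomic n ℤ ^ k := by
  have hn0 : 0 < n := by omega
  have hF := finiteMultiplicity_of_degree_pos_of_monic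
    (degree_cyclotomic_pos n ℤ hn0) (cyclotomic.monic n ℤ) hq.ne_zero
  obtain ⟨r, hr, hnd⟩ := hF.exists_eq_pow_mul_and_not_dvd
  set k := multiplicity (cyclotomic n ℤ) q
  have hrm : r.Monic := ((cyclotomic.monic n ℤ).pow k).of_mul_monic_left (hr ▸ hq)
  refine ⟨k, ?_⟩
  suffices r = 1 by rw [hr, this, mul_one]
  by_contra hr1
  have hdeg : 0 < r.degree := hrm.degree_pos.mpr hr1
  obtain ⟨z, hz⟩ := IsAlgClosed.exists_aeval_eq_zero ℂ r hdeg.ne'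
  have hp : IsPrimitiveRoot z n := h z (by rw [hr]; simp [hz])
  apply hnd
  rw [cyclotomic_eq_minpoly hp hn0]
  exact minpoly.isIntegrallyClosed_dvd (hp.isIntegral hn0) hz


open TensorProduct in
/-- For a positive definite even lattice `L` of rank `ℓ` and a completely
fixed point free isometry `g ∈ O(L)` of order `n ≥ 2`, the eigenspace of `g` on
`𝔥 = ℂ ⊗ L` with eigenvalue `e^{2πij/n}` has dimension `ℓ/φ(n)` if `gcd(j,n) = 1`
and dimension `0` otherwise, for `0 ≤ j ≤ n−1`. -/
theorem eigenspace_dim_of_completely_fixed_point_free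
    (L : Type*) [AddCommGroup L] [Module ℤ L] [Module.Free ℤ L] [Module.Finite ℤ L]
    (B : L →ₗ[ℤ] L →ₗ[ℤ] ℤ)
    (hsymm : ∀ x y : L, B x y = B y x)
    (hpos : ∀ x : L, x ≠ 0 → 0 < B x x)
    (heven : ∀ x : L, 2 ∣ B x x)
    (g : L ≃ₗ[ℤ] L)
    (hg : ∀ x y : L, B (g x) (g y) = B x y)
    (n : ℕ) (hn : 2 ≤ n) (horder : orderOf g = n)
    (hfpf : ∀ i : ℕ, 1 ≤ i → i ≤ n - 1 → ∀ α : L, (g ^ i) α = α → α = 0) :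
    ∀ j : ℕ, j ≤ n - 1 →
      Module.finrank ℂ
        (Module.End.eigenspace (LinearMap.baseChange ℂ g.toLinearMap)
          (Complex.exp (2 * Real.pi * Complex.I * (j : ℂ) / (n : ℂ)))) =
      if Nat.gcd j n = 1 then Module.finrank ℤ L / Nat.totient n else 0 := by
  classical
  intro j hj
  have hn0 : 0 < n := by omega
  have : NeZero ((n : ℕ) : ℂ) := ⟨by exact_mod_cast hn0.ne'⟩
  have hpow : ∀ i : ℕ, ∀ x : L, ((g.toLinearMap : Module.End ℤ L) ^ i) x = (g ^ i) x := by
    intro i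
    induction i with
    | zero => intro x; simp
    | succ i ih => 
      intro x
      rw [pow_succ, pow_succ, Module.End.mul_apply, ih]
      rfl
  have hgn : (g.toLinearMap : Module.End ℤ L) ^ n = 1 := by
    ext x
    rw [hpow, ← horder, pow_orderOf_eq_one]
    rfl
  have hcyc := cffp_aeval_cyclotomic (g.toLinearMap : Module.End ℤ L) n hn hgn
    (fun i h1 h2 α hα => hfpf i h1 h2 α (by rw [← hpow]; exact hα))
  set G : Module.End ℂ (ℂ ⊗[ℤ] L) := LinearMap.baseChange ℂ g.toLinearMap with hG
  have hGcyc : Polynomial.aeval G (Polynomial.cyclotomic n ℂ) = 0 := by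
    let Φ : Module.End ℤ L →+* Module.End ℂ (ℂ ⊗[ℤ] L) :=
      { toFun := fun f => LinearMap.baseChange ℂ f
        map_one' := LinearMap.baseChange_one _ _
        map_mul' := fun a b => LinearMap.baseChange_mul a b
        map_zero' := LinearMap.baseChange_zero
        map_add' := fun a b => LinearMap.baseChange_add a b }
    have h1 : ((Polynomial.aeval G : Polynomial ℂ →ₐ[ℂ] _) : Polynomial ℂ →+* _).comp
          (Polynomial.mapRingHom (Int.castRingHom ℂ)) =
        Φ.comp
          ((Polynomial.aeval (g.toLinearMap : Module.End ℤ L) : Polynomial ℤ →ₐ[ℤ] _) :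
            Polynomial ℤ →+* _) := by
      apply Polynomial.ringHom_ext'
      · exact RingHom.ext_int _ _
      · simp only [RingHom.comp_apply, Polynomial.coe_mapRingHom, Polynomial.map_X,
          RingHom.coe_coe, Polynomial.aeval_X]
        rfl
    have h2 := RingHom.congr_fun h1 (Polynomial.cyclotomic n ℤ)
    simp only [RingHom.comp_apply, Polynomial.coe_mapRingHom, Polynomial.map_cyclotomic_int,
      RingHom.coe_coe] at h2
    rw [h2, hcyc, map_zero]
  have heig : ∀ z : ℂ, G.HasEigenvalue z → IsPrimitiveRoot z n := by
    intro z hz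
    obtain ⟨v, hv⟩ := hz.exists_hasEigenvector
    have h1 := Module.End.aeval_apply_of_hasEigenvector (p := Polynomial.cyclotomic n ℂ) hv
    rw [hGcyc, LinearMap.zero_apply] at h1
    have h2 := (smul_eq_zero.mp h1.symm).resolve_right hv.2
    exact Polynomial.isRoot_cyclotomic_iff.mp h2
  have hchar : G.charpoly = (LinearMap.charpoly g.toLinearMap).map (algebraMap ℤ ℂ) :=
    LinearMap.charpoly_baseChange _ _
  obtain ⟨k, hk⟩ := cffp_poly n hn (LinearMap.charpoly g.toLinearMap)
    (LinearMap.charpoly_monic _) (by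
      intro z hz
      apply heig
      rw [Module.End.hasEigenvalue_iff_isRoot_charpoly, hchar, Polynomial.IsRoot,
        Polynomial.eval_map_algebraMap]
      exact hz)
  have hexp : IsPrimitiveRoot (Complex.exp (2 * Real.pi * Complex.I * (j : ℂ) / (n : ℂ))) n ↔
      Nat.gcd j n = 1 := by
    rw [← Nat.coprime_iff_gcd_eq_one,
      ← (Complex.isPrimitiveRoot_exp n hn0.ne').pow_iff_coprime hn0 j, ← Complex.exp_nat_mul]
    rw [show 2 * Real.pi * Complex.I * (j : ℂ) / (n : ℂ) =
      (j : ℂ) * (2 * Real.pi * Complex.I / (n : ℂ)) by ring]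
  set ζ := Complex.exp (2 * Real.pi * Complex.I * (j : ℂ) / (n : ℂ))
  split_ifs with hgcd
  · have hζ := hexp.mpr hgcd
    have hsep : (Polynomial.cyclotomic n ℂ).Separable := Polynomial.separable_cyclotomic n ℂ
    have hss : G.IsSemisimple :=
      Module.End.isSemisimple_of_squarefree_aeval_eq_zero hsep.squarefree hGcyc
    rw [← hss.isFinitelySemisimple.maxGenEigenspace_eq_eigenspace,
      LinearMap.finrank_maxGenEigenspace_eq]
    have hrank : Module.finrank ℤ L = k * Nat.totient n := by
      rw [← LinearMap.charpoly_natDegree g.toLinearMap, hk, Polynomial.natDegree_pow,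
        Polynomial.natDegree_cyclotomic]
    rw [hrank, Nat.mul_div_cancel _ (Nat.totient_pos.mpr hn0), hchar, hk, Polynomial.map_pow,
      ← Polynomial.count_roots, Polynomial.roots_pow, Multiset.count_nsmul]
    rw [show algebraMap ℤ ℂ = Int.castRingHom ℂ from rfl, Polynomial.map_cyclotomic_int,
      Multiset.count_eq_one_of_mem (Polynomial.nodup_roots hsep), mul_one]
    rw [Polynomial.mem_roots (Polynomial.cyclotomic_ne_zero n ℂ)]
    exact Polynomial.isRoot_cyclotomic_iff.mpr hζ
  · have : ¬ G.HasEigenvalue ζ := fun h => hgcd (hexp.mp (heig ζ h))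
    rw [Module.End.hasEigenvalue_iff, not_not] at this
    rw [this]
    simp
end

section
/- Let L be a positive definite even lattice, let g ∈ O(L) be a completely fixed point free isometry of order n ≥ 2, and let λ ∈ L* = {α ∈ ℚ ⊗_ℤ L : (α|β) ∈ ℤ for all β ∈ L} be an element of the dual lattice with (1 − g)λ ∈ L. Then Φ_n(1)·λ ∈ L; in particular λ ∈ L if n is not a prime power, and p·λ ∈ L if n = p^k is a prime power. -/
theorem aux_clear {V : Type*} [AddCommGroup V] [Module ℚ V] (L : Submodule ℤ V)
    (hspan : Submodule.span ℚ (L : Set V) = ⊤) (v : V) :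
    ∃ m : ℤ, m ≠ 0 ∧ m • v ∈ L := by
  have hv : v ∈ Submodule.span ℚ (L : Set V) := by rw [hspan]; trivial
  induction hv using Submodule.span_induction with
  | mem x hx => exact ⟨1, one_ne_zero, by simpa using hx⟩
  | zero => exact ⟨1, one_ne_zero, by simp⟩
  | add x y _ _ hx hy =>
    obtain ⟨a, ha, hax⟩ := hx
    obtain ⟨b, hb, hby⟩ := hy
    refine ⟨a * b, mul_ne_zero ha hb, ?_⟩
    rw [smul_add]
    refine L.add_mem ?_ ?_
    · rw [mul_comm, mul_smul]; exact L.smul_mem _ hax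
    · rw [mul_smul]; exact L.smul_mem _ hby
  | smul q x _ hx =>
    obtain ⟨a, ha, hax⟩ := hx
    refine ⟨a * q.den, mul_ne_zero ha (by exact_mod_cast q.den_nz), ?_⟩
    have : (a * (q.den : ℤ)) • q • x = q.num • (a • x) := by
      simp only [← Int.cast_smul_eq_zsmul ℚ, smul_smul]
      congr 1
      push_cast
      have := Rat.mul_den_eq_num q
      linear_combination (a : ℚ) * this
    rw [this]
    exact L.smul_mem _ hax

theorem aux_aeval_mem {V : Type*} [AddCommGroup V] [Module ℚ V] (L : Submodule ℤ V)
    (f : Module.End ℚ V) (hf : ∀ x ∈ L, f x ∈ L) (q : Polynomial ℤ) :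
    ∀ x ∈ L, (Polynomial.aeval f q) x ∈ L := by
  induction q using Polynomial.induction_on' with
  | add p q hp hq =>
    intro x hx
    rw [map_add, LinearMap.add_apply]
    exact L.add_mem (hp x hx) (hq x hx)
  | monomial k a =>
    intro x hx
    have h : ∀ k : ℕ, (f ^ k) x ∈ L := by
      intro k
      induction k with
      | zero => simpa using hx
      | succ k ih => rw [pow_succ']; exact hf _ ih
    rw [Polynomial.aeval_monomial]
    have : (algebraMap ℤ (Module.End ℚ V) a * f ^ k) x = a • (f ^ k) x := by
      rw [← Algebra.smul_def]; rfl
    rw [this]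
    exact L.smul_mem _ (h k)

/-- Let `L` be a positive definite even lattice (realized inside the
rational vector space `V` it spans), `g ∈ O(L)` completely fixed point free of order
`n ≥ 2`, and `λ ∈ L*` an element of the dual lattice with `(1−g)λ ∈ L`.
Then `Φ_n(1)·λ ∈ L`; in particular `λ ∈ L` if `n` is not a prime power, and
`p·λ ∈ L` if `n = p^k` is a prime power. -/
theorem dual_vector_multiple_in_lattice
    (V : Type*) [AddCommGroup V] [Module ℚ V] [FiniteDimensional ℚ V]
    (B : V →ₗ[ℚ] V →ₗ[ℚ] ℚ)
    (hsymm : ∀ x y : V, B x y = B y x)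
    (hpos : ∀ x : V, x ≠ 0 → 0 < B x x)
    (L : Submodule ℤ V)
    (hspan : Submodule.span ℚ (L : Set V) = ⊤)
    (hint : ∀ α ∈ L, ∀ β ∈ L, ∃ k : ℤ, B α β = (k : ℚ))
    (heven : ∀ α ∈ L, ∃ k : ℤ, B α α = 2 * (k : ℚ))
    (g : V ≃ₗ[ℚ] V)
    (hgB : ∀ x y : V, B (g x) (g y) = B x y)
    (hgL : ∀ α : V, α ∈ L ↔ g α ∈ L)
    (n : ℕ) (hn : 2 ≤ n) (horder : orderOf g = n)
    (hfpf : ∀ i : ℕ, 1 ≤ i → i ≤ n - 1 → ∀ α ∈ L, (g ^ i) α = α → α = 0)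
    (lam : V)
    (hdual : ∀ β ∈ L, ∃ k : ℤ, B lam β = (k : ℚ))
    (hlam : lam - g lam ∈ L) :
    ((((Polynomial.cyclotomic n ℤ).eval 1 : ℤ) : ℚ) • lam ∈ L) ∧
    (¬ IsPrimePow n → lam ∈ L) ∧
    (∀ p k : ℕ, p.Prime → 1 ≤ k → n = p ^ k → (p : ℚ) • lam ∈ L) := by
  have hpow : ∀ (i : ℕ) (x : V), ((g : Module.End ℚ V) ^ i) x = (g ^ i) x := by
    intro i
    induction i with
    | zero => intro x; simp
    | succ k ih => intro x; rw [pow_succ', pow_succ']; simp [ih]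
  set f : Module.End ℚ V := (g : Module.End ℚ V) with hf
  have hfix : ∀ i : ℕ, 1 ≤ i → i ≤ n - 1 → ∀ v : V, (f ^ i) v = v → v = 0 := by
    intro i h1 h2 v hv
    obtain ⟨m, hm, hmL⟩ := aux_clear L hspan v
    have h := hfpf i h1 h2 (m • v) hmL (by rw [← hpow, map_zsmul, hv])
    rw [← Int.cast_smul_eq_zsmul ℚ] at h
    rcases smul_eq_zero.mp h with h | h
    · exact absurd (by exact_mod_cast h) hm
    · exact h
  have hinj : ∀ d ∈ n.properDivisors, ∀ v : V,
      (Polynomial.aeval f (Polynomial.cyclotomic d ℤ)) v = 0 → v = 0 := by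
    intro d hd v hv
    rw [Nat.mem_properDivisors] at hd
    have hd1 : 1 ≤ d := Nat.pos_of_dvd_of_pos hd.1 (by omega)
    refine hfix d hd1 (by omega) v ?_
    obtain ⟨c, hc⟩ := Polynomial.cyclotomic.dvd_X_pow_sub_one d ℤ
    have h := congrArg (fun P => (Polynomial.aeval f P) v) hc
    simp only [mul_comm _ c, map_mul, Module.End.mul_apply, hv, map_zero, map_sub, map_pow,
      Polynomial.aeval_X, map_one, LinearMap.sub_apply, Module.End.one_apply] at h
    exact sub_eq_zero.mp h
  have hprod : ∀ S : Finset ℕ, S ⊆ n.properDivisors → ∀ v : V,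
      (Polynomial.aeval f (∏ d ∈ S, Polynomial.cyclotomic d ℤ)) v = 0 → v = 0 := by
    intro S
    induction S using Finset.induction_on with
    | empty => intro _ v hv; simpa using hv
    | insert a S ha ih =>
      intro hS v hv
      rw [Finset.prod_insert ha, map_mul, Module.End.mul_apply] at hv
      exact ih (fun x hx => hS (Finset.mem_insert_of_mem hx)) v
        (hinj a (hS (Finset.mem_insert_self _ _)) _ hv)
  have hcyc : ∀ v : V, (Polynomial.aeval f (Polynomial.cyclotomic n ℤ)) v = 0 := by
    intro v
    apply hprod _ (Finset.Subset.refl _)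
    rw [← Module.End.mul_apply, ← map_mul]
    have h := Polynomial.prod_cyclotomic_eq_X_pow_sub_one (n := n) (by omega) ℤ
    rw [← Nat.cons_self_properDivisors (by omega), Finset.prod_cons, mul_comm] at h
    rw [h]
    have h1 : (f ^ n) v = v := by rw [hpow, ← horder, pow_orderOf_eq_one]; rfl
    simp [h1]
  have main : (((Polynomial.cyclotomic n ℤ).eval 1 : ℤ) : ℚ) • lam ∈ L := by
    obtain ⟨q, hq⟩ := Polynomial.X_sub_C_dvd_sub_C_eval (a := (1 : ℤ))
      (p := Polynomial.cyclotomic n ℤ)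
    have h := congrArg (fun P => (Polynomial.aeval f P) lam) hq
    simp only [mul_comm _ q, map_mul, Module.End.mul_apply, map_sub,
      Polynomial.aeval_X, LinearMap.sub_apply, hcyc, Polynomial.aeval_C] at h
    have e : ∀ a : ℤ, (algebraMap ℤ (Module.End ℚ V) a) lam = (a : ℚ) • lam := by
      intro a
      rw [Algebra.algebraMap_eq_smul_one, Int.cast_smul_eq_zsmul]; rfl
    rw [e, e, zero_sub, Int.cast_one, one_smul, ← map_sub, ← neg_sub lam (f lam), map_neg,
      neg_inj] at h
    rw [h]
    exact aux_aeval_mem L f (fun x hx => (hgL x).mp hx) q _ hlam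
  refine ⟨main, ?_, ?_⟩
  · intro hpp
    rw [Polynomial.eval_one_cyclotomic_not_prime_pow] at main
    · simpa using main
    · intro p hp k hk
      rcases Nat.eq_zero_or_pos k with rfl | hk0
      · simp at hk; omega
      · exact hpp (hk ▸ hp.isPrimePow.pow hk0.ne')
  · intro p k hp hk hnk
    obtain ⟨j, rfl⟩ : ∃ j, k = j + 1 := ⟨k - 1, by omega⟩
    have := Fact.mk hp
    rw [hnk, Polynomial.eval_one_cyclotomic_prime_pow] at main
    simpa using main
end

section
/- Let L be a positive definite even lattice of rank ℓ and let g ∈ O(L) be a completely fixed point free isometry of order n ≥ 2. Then the index of the sublattice (1 − g)L in L is finite and equals Φ_n(1)^{ℓ/φ(n)}; that is, |L/(1−g)L| = 1 (i.e., (1−g)L = L) if n is not a prime power, and |L/(1−g)L| = p^{ℓ/φ(n)} if n = p^k is a prime power. -/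
open Polynomial in
theorem aux_charpoly_dvd {ι : Type*} [Fintype ι] [DecidableEq ι] (A : Matrix ι ι ℤ) (p : ℤ[X])
    (h : aeval A p = 0) : A.charpoly ∣ p ^ Fintype.card ι := by
  set M : Matrix ι ι ℤ[X] := (C : ℤ →+* ℤ[X]).mapMatrix A with hM
  have h1 := sub_dvd_eval_sub (C (X : ℤ[X]) : ℤ[X][X]) X (p.map (algebraMap ℤ ℤ[X][X]))
  rw [eval_map_algebraMap, eval_map_algebraMap] at h1
  obtain ⟨q, hq⟩ := h1
  have h2 := congrArg (aeval M) hq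
  have h3 : aeval M p = 0 := by
    have := aeval_algHom_apply ((Algebra.ofId ℤ ℤ[X]).mapMatrix : Matrix ι ι ℤ →ₐ[ℤ] _) A p
    rw [h, map_zero] at this
    rw [← this]
    congr 1
  have h4 : aeval M (aeval (X : ℤ[X][X]) p) = 0 := by
    have := aeval_algHom_apply ((aeval M : ℤ[X][X] →ₐ[ℤ[X]] _).restrictScalars ℤ) X p
    simp only [AlgHom.restrictScalars_apply, aeval_X] at this
    rw [← this, h3]
  have h5 : aeval M (aeval (C (X : ℤ[X]) : ℤ[X][X]) p) = algebraMap ℤ[X] _ p := by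
    have h6 : aeval (C (X : ℤ[X]) : ℤ[X][X]) p = C p := by
      have := aeval_algHom_apply (Algebra.ofId ℤ[X] ℤ[X][X] |>.restrictScalars ℤ) X p
      simp only [AlgHom.restrictScalars_apply, aeval_X_left, AlgHom.id_apply] at this
      exact this
    rw [h6, aeval_C]
  rw [map_sub, h4, h5, sub_zero, map_mul, map_sub, aeval_C, aeval_X] at h2
  have h7 := congrArg Matrix.det h2
  rw [Matrix.det_mul, Matrix.algebraMap_eq_diagonal, Matrix.det_diagonal] at h7
  refine ⟨Matrix.det (aeval M q), ?_⟩
  rw [Matrix.charpoly]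
  convert h7 using 1
  · simp
  · rfl

open Polynomial in
theorem aux_aeval_cyclotomic {L : Type*} [AddCommGroup L] (f : Module.End ℤ L) (n : ℕ) (hn : 0 < n)
    (hf : f ^ n = 1)
    (hfpf : ∀ i : ℕ, 1 ≤ i → i < n → ∀ α : L, (f ^ i) α = α → α = 0) :
    aeval f (cyclotomic n ℤ) = 0 := by
  have h0 : aeval f (X ^ n - 1 : ℤ[X]) = 0 := by simp [hf]
  rw [← prod_cyclotomic_eq_X_pow_sub_one hn, ← Nat.cons_self_properDivisors hn.ne',
    Finset.prod_cons, mul_comm, map_mul] at h0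
  have hinj : ∀ s ⊆ n.properDivisors, ∀ x : L, aeval f (∏ d ∈ s, cyclotomic d ℤ) x = 0 → x = 0 := by
    intro s
    induction s using Finset.induction_on with
    | empty => intro _ x hx; simpa using hx
    | insert a s ha ih =>
      intro hs x hx
      rw [Finset.prod_insert ha, map_mul, Module.End.mul_apply] at hx
      refine ih (fun y hy => hs (Finset.mem_insert_of_mem hy)) x ?_
      have ha2 := Nat.mem_properDivisors.1 (hs (Finset.mem_insert_self a s))
      have hapos : 0 < a := Nat.pos_of_dvd_of_pos ha2.1 hn
      refine hfpf a hapos ha2.2 _ ?_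
      obtain ⟨q, hq⟩ := cyclotomic.dvd_X_pow_sub_one a ℤ
      have := congrArg (fun r => aeval f r (aeval f (∏ d ∈ s, cyclotomic d ℤ) x)) hq
      simp only [mul_comm (cyclotomic a ℤ) q] at this
      rw [map_mul, Module.End.mul_apply, hx] at this
      simpa [sub_eq_zero] using this
  ext x
  exact hinj _ (Finset.Subset.refl _) _ (by
    have := congrArg (fun r : Module.End ℤ L => r x) h0
    simpa only [Module.End.mul_apply, LinearMap.zero_apply] using this)

open Polynomial in
theorem aux_det {L : Type*} [AddCommGroup L] [Module.Free ℤ L] [Module.Finite ℤ L]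
    (f : Module.End ℤ L) (n : ℕ) (hn : 0 < n) (h : aeval f (cyclotomic n ℤ) = 0) :
    LinearMap.det (1 - f) = (eval 1 (cyclotomic n ℤ)) ^ (Module.finrank ℤ L / Nat.totient n) := by
  classical
  let b := Module.Free.chooseBasis ℤ L
  let A := LinearMap.toMatrixAlgEquiv b f
  have hA : aeval A (cyclotomic n ℤ) = 0 := by
    have := aeval_algHom_apply (LinearMap.toMatrixAlgEquiv b).toAlgHom f (cyclotomic n ℤ)
    rw [h, map_zero] at this
    exact this
  have hd := aux_charpoly_dvd A _ hA
  have hp : Prime (cyclotomic n ℤ) := (cyclotomic.irreducible hn).prime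
  obtain ⟨k, -, hk⟩ := (dvd_prime_pow hp _).1 hd
  have hk2 := eq_of_monic_of_associated A.charpoly_monic ((cyclotomic.monic n ℤ).pow k) hk
  have hdeg := congrArg natDegree hk2
  rw [Matrix.charpoly_natDegree_eq_dim, (cyclotomic.monic n ℤ).natDegree_pow, natDegree_cyclotomic,
    ← Module.finrank_eq_card_basis b] at hdeg
  rw [hdeg, Nat.mul_div_cancel _ (Nat.totient_pos.2 hn), ← eval_pow, ← hk2, Matrix.eval_charpoly,
    ← LinearMap.det_toMatrix b, map_sub]
  congr 1
  rw [LinearMap.toMatrix_one]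
  simp [A, LinearMap.toMatrixAlgEquiv]

theorem aux_card {L : Type*} [AddCommGroup L] [Module.Free ℤ L] [Module.Finite ℤ L]
    (f : Module.End ℤ L) (hf : Function.Injective f) :
    Nat.card (L ⧸ LinearMap.range f) = (LinearMap.det f).natAbs := by
  rw [← Submodule.natAbs_det_equiv _ (LinearEquiv.ofInjective f hf)]
  congr 2

theorem index_one_sub_g
    (L : Type*) [AddCommGroup L] [Module ℤ L] [Module.Free ℤ L] [Module.Finite ℤ L]
    (B : L →ₗ[ℤ] L →ₗ[ℤ] ℤ)
    (hsymm : ∀ x y : L, B x y = B y x)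
    (hpos : ∀ x : L, x ≠ 0 → 0 < B x x)
    (heven : ∀ x : L, 2 ∣ B x x)
    (g : L ≃ₗ[ℤ] L)
    (hg : ∀ x y : L, B (g x) (g y) = B x y)
    (n : ℕ) (hn : 2 ≤ n) (horder : orderOf g = n)
    (hfpf : ∀ i : ℕ, 1 ≤ i → i ≤ n - 1 → ∀ α : L, (g ^ i) α = α → α = 0)
    (S : Submodule ℤ L) (hS : S = LinearMap.range (LinearMap.id - g.toLinearMap)) :
    (0 < Nat.card (L ⧸ S)) ∧
    ((Nat.card (L ⧸ S) : ℤ) =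
      ((Polynomial.cyclotomic n ℤ).eval 1) ^ (Module.finrank ℤ L / Nat.totient n)) ∧
    (¬ IsPrimePow n → S = ⊤) ∧
    (∀ p k : ℕ, p.Prime → 1 ≤ k → n = p ^ k →
      Nat.card (L ⧸ S) = p ^ (Module.finrank ℤ L / Nat.totient n)) := by
  rename_i i1 i2 i3 i4
  obtain rfl : i2 = AddCommGroup.toIntModule L := Subsingleton.elim _ _
  have hpow : ∀ (i : ℕ) (x : L), ((g.toLinearMap : Module.End ℤ L) ^ i) x = (g ^ i) x := by
    intro i
    induction i with
    | zero => intro x; rfl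
    | succ i ih => intro x; rw [pow_succ, pow_succ, Module.End.mul_apply, ih]; rfl
  have hgn : (g.toLinearMap : Module.End ℤ L) ^ n = 1 := by
    ext x
    rw [hpow, ← horder, pow_orderOf_eq_one]; rfl
  have h1 := aux_aeval_cyclotomic g.toLinearMap n (by omega) hgn
    (fun i hi hin α ha => hfpf i hi (by omega) α (by rw [← hpow]; exact ha))
  have h2 := aux_det _ n (by omega) h1
  have hinj : Function.Injective (1 - g.toLinearMap : Module.End ℤ L) := by
    rw [injective_iff_map_eq_zero]
    intro x hx
    refine hfpf 1 le_rfl (by omega) x ?_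
    rw [← hpow]
    have hx2 : x - g x = 0 := hx
    exact (sub_eq_zero.1 hx2).symm
  have h3 := aux_card _ hinj
  have hS' : S = LinearMap.range (1 - g.toLinearMap : Module.End ℤ L) := hS
  rw [← hS', h2] at h3
  have hnp : ¬ IsPrimePow n → (Polynomial.cyclotomic n ℤ).eval 1 = 1 := by
    intro h
    refine Polynomial.eval_one_cyclotomic_not_prime_pow ?_
    intro p hp k hk
    refine h ((isPrimePow_nat_iff n).2 ⟨p, k, hp, ?_, hk⟩)
    rcases Nat.eq_zero_or_pos k with rfl | h
    · simp at hk; omega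
    · exact h
  have hpp : ∀ p k : ℕ, p.Prime → 1 ≤ k → n = p ^ k →
      (Polynomial.cyclotomic n ℤ).eval 1 = p := by
    intro p k hp hk h
    obtain ⟨k, rfl⟩ := Nat.exists_eq_add_of_le' hk
    haveI := Fact.mk hp
    rw [h, Polynomial.eval_one_cyclotomic_prime_pow]
  have hposc : 0 < (Polynomial.cyclotomic n ℤ).eval 1 := by
    by_cases h : IsPrimePow n
    · obtain ⟨p, k, hp, hk, h⟩ := (isPrimePow_nat_iff n).1 h
      rw [hpp p k hp hk h.symm]
      exact_mod_cast hp.pos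
    · rw [hnp h]; norm_num
  have h4 : (Nat.card (L ⧸ S) : ℤ) =
      ((Polynomial.cyclotomic n ℤ).eval 1) ^ (Module.finrank ℤ L / Nat.totient n) := by
    rw [h3]
    exact Int.natAbs_of_nonneg (pow_pos hposc _).le
  refine ⟨?_, h4, ?_, ?_⟩
  · have := pow_pos hposc (Module.finrank ℤ L / Nat.totient n)
    rw [← h4] at this
    exact_mod_cast this
  · intro h
    rw [hnp h, one_pow] at h4
    have h5 : Nat.card (L ⧸ S) = 1 := by exact_mod_cast h4
    have := (Nat.card_eq_one_iff_unique.1 h5).1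
    exact Submodule.Quotient.subsingleton_iff.1 this
  · intro p k hp hk h
    rw [hpp p k hp hk h] at h4
    exact_mod_cast h4
end

section
/- Let p be a prime and r ≥ 1 an integer such that (p^{2r−1} + 1) divides 24·(p^r − 1)·p^{r−1} and the integer ℓ = 24·(p^r − 1)·p^{r−1}/(p^{2r−1} + 1) satisfies ℓ ≥ p^{r−1}(p − 1). Then either r = 1 and p ∈ {2, 3, 5, 7, 11, 23}, or (p, r) = (2, 2). -/
theorem prime_power_rank_constraint (p r : ℕ) (hp : p.Prime) (hr : 1 ≤ r)
    (hdvd : (p ^ (2 * r - 1) + 1) ∣ 24 * (p ^ r - 1) * p ^ (r - 1))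
    (ℓ : ℕ) (hℓ : ℓ = 24 * (p ^ r - 1) * p ^ (r - 1) / (p ^ (2 * r - 1) + 1))
    (hrank : p ^ (r - 1) * (p - 1) ≤ ℓ) :
    (r = 1 ∧ p ∈ ({2, 3, 5, 7, 11, 23} : Finset ℕ)) ∨ (p = 2 ∧ r = 2) := by
  have h2 := hp.two_le
  have hlt : ℓ < 24 := by
    rw [hℓ, Nat.div_lt_iff_lt_mul (by positivity)]
    have e : p ^ (2 * r - 1) = p ^ r * p ^ (r - 1) := by
      rw [← pow_add]; congr 1; omega
    rw [e]
    have h := Nat.mul_le_mul_right (p ^ (r - 1)) (Nat.sub_le (p ^ r) 1)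
    rw [mul_assoc]
    omega
  have hq : 0 < p ^ (r - 1) := by positivity
  have hp24 : p ≤ 24 := by
    have := Nat.le_mul_of_pos_left (p - 1) hq
    omega
  have hr5 : r - 1 < 5 := by
    have h1 := Nat.le_mul_of_pos_right (p ^ (r - 1)) (show 0 < p - 1 by omega)
    have h3 : 2 ^ (r - 1) ≤ p ^ (r - 1) := Nat.pow_le_pow_left h2 _
    apply (Nat.pow_lt_pow_iff_right (a := 2) (by norm_num)).1
    norm_num at *
    omega
  have hr6 : r ≤ 5 := by omega
  subst hℓ
  clear hq hr5 hlt
  interval_cases r <;> interval_cases p <;> revert hp hdvd hrank <;> norm_num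
end
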